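/- For every integer r ≥ 2 and every d with 0 < d ≤ 2/3 there exist ε₀ > 0 and n₀ such that the following holds for all 0 < ε ≤ ε₀ and n ≥ n₀. Let G be an r-partite graph with parts A₁,…,A_r, each of size n, such that for all i ≠ j the pair G[A_i,A_j] is (d_{i,j}, ε)-super-regular for some d_{i,j} ≥ d. Let 𝓗 be the r-uniform hypergraph whose hyperedges are the vertex sets of the r-partite r-cliques of G (one vertex in each part). Then there exists a weighting ω: 𝓗 → [0,1] such that for every vertex v ∈ A₁ ∪ ⋯ ∪ A_r one has Σ_{H ∈ 𝓗, H ∋ v} ω(H) = (1/2)·n^{r−1}·∏_{1 ≤ i < j ≤ r} d_{i,j}. -/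

import Mathlib

open Finset

variable {V : Type*} [Fintype V] [DecidableEq V]

/-- The number of neighbours of `v` in the set `B`. -/
def nbrCount (G : SimpleGraph V) [DecidableRel G.Adj] (v : V) (B : Finset V) : ℕ :=
  (B.filter (fun w => G.Adj v w)).card

/-- The edge density `d_G(A,B) = e_G(A,B)/(|A||B|)` between the vertex sets `A` and `B`. -/
noncomputable def pairDensity (G : SimpleGraph V) [DecidableRel G.Adj] (A B : Finset V) : ℝ :=
  (∑ v ∈ A, (nbrCount G v B : ℝ)) / ((A.card : ℝ) * (B.card : ℝ))

/-- The pair `(A,B)` is `(d,ε)`-regular in `G`: it has density `d`, and all pairs of subsets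
`X ⊆ A`, `Y ⊆ B` with `|X| ≥ ε|A|`, `|Y| ≥ ε|B|` have density within `ε` of `d`. -/
def IsRegularPair (G : SimpleGraph V) [DecidableRel G.Adj] (A B : Finset V) (d ε : ℝ) : Prop :=
  pairDensity G A B = d ∧
    ∀ X ⊆ A, ∀ Y ⊆ B, ε * A.card ≤ X.card → ε * B.card ≤ Y.card →
      |pairDensity G X Y - d| ≤ ε

/-- The pair `(A,B)` is `(d,ε,δ')`-super-regular in `G`: it is `(d,ε)`-regular and every vertex
of one side has at least `δ'` times the size of the other side many neighbours there. -/
def IsSuperRegular3 (G : SimpleGraph V) [DecidableRel G.Adj] (A B : Finset V)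
    (d ε δ' : ℝ) : Prop :=
  IsRegularPair G A B d ε ∧
    (∀ v ∈ A, δ' * B.card ≤ (nbrCount G v B : ℝ)) ∧
    (∀ v ∈ B, δ' * A.card ≤ (nbrCount G v A : ℝ))

/-- `(d,ε)`-super-regular means `(d,ε,d-ε)`-super-regular. -/
def IsSuperRegular (G : SimpleGraph V) [DecidableRel G.Adj] (A B : Finset V) (d ε : ℝ) : Prop :=
  IsSuperRegular3 G A B d ε (d - ε)

open Classical in
/-- The `r`-partite `r`-cliques of `G` with respect to the parts `A i`: cliques having exactly
one vertex in each part. -/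
noncomputable def transvCliques {V : Type*} [Fintype V] [DecidableEq V] (G : SimpleGraph V)
    {r : ℕ} (A : Fin r → Finset V) : Finset (Finset V) :=
  Finset.univ.filter (fun K : Finset V => G.IsClique ↑K ∧ ∀ i, (K ∩ A i).card = 1)

section System

variable {r n : ℕ}

/-- A sum over tuples is an average of sums in which one coordinate is resampled. -/
lemma sum_sum_update (i : Fin r) (H : (Fin r → Fin n) → ℝ) :
    ∑ x : Fin r → Fin n, ∑ a : Fin n, H (Function.update x i a) = n * ∑ x, H x := by
  have hinv : Function.Involutive
      (fun q : (Fin r → Fin n) × Fin n => (Function.update q.1 i q.2, q.1 i)) := by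
    rintro ⟨x, a⟩
    simp
  have h := Equiv.sum_comp hinv.toPerm (fun q : (Fin r → Fin n) × Fin n => H q.1)
  simp only [Function.Involutive.coe_toPerm, Fintype.sum_prod_type] at h
  rw [h]
  simp [Finset.mul_sum]

/-- The sum over tuples with a prescribed coordinate, as a sum over all tuples. -/
lemma sum_update (i : Fin r) (a : Fin n) (H : (Fin r → Fin n) → ℝ) :
    ∑ x : Fin r → Fin n, H (Function.update x i a) = n * ∑ x, if x i = a then H x else 0 := by
  rw [← sum_sum_update i]
  refine Finset.sum_congr rfl fun x _ => ?_
  simp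

lemma sum_apply_coord (i : Fin r) (g : Fin n → ℝ) :
    n * ∑ x : Fin r → Fin n, g (x i) = (n : ℝ) ^ r * ∑ a, g a := by
  rw [← sum_sum_update i]
  simp

/-- The index pairs `(i, j)` with `i < j`. -/
def upperPairs (r : ℕ) : Finset (Fin r × Fin r) := Finset.univ.filter fun p => p.1 < p.2

/-- The index pairs `(j, k)` with `j < k` that avoid the index `i`. -/
def upperPairsAvoiding (i : Fin r) : Finset (Fin r × Fin r) :=
  (upperPairs r).filter fun p => p.1 ≠ i ∧ p.2 ≠ i

lemma prod_upperPairs (i : Fin r) (c : Fin r → Fin r → ℝ) (hsymm : ∀ j k, c j k = c k j)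
    (hdiag : c i i = 1) :
    ∏ p ∈ upperPairs r, c p.1 p.2 =
      (∏ j, c i j) * ∏ p ∈ upperPairsAvoiding i, c p.1 p.2 := by
  rw [← Finset.prod_filter_mul_prod_filter_not (upperPairs r) (fun p => p.1 ≠ i ∧ p.2 ≠ i),
    mul_comm, ← Finset.mul_prod_erase Finset.univ _ (Finset.mem_univ i), hdiag, one_mul]
  congr 1
  symm
  refine Finset.prod_bij' (fun j _ => (min i j, max i j))
    (fun p _ => if p.1 = i then p.2 else p.1) ?_ ?_ ?_ ?_ ?_
  · intro j hj
    have hj' : j ≠ i := by simpa using hj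
    rcases lt_or_gt_of_ne hj' with h | h
    · simp [upperPairs, min_eq_right h.le, max_eq_left h.le, h]
    · simp [upperPairs, min_eq_left h.le, max_eq_right h.le, h]
  · rintro ⟨j, k⟩ hp
    simp only [upperPairs, Finset.mem_filter, Finset.mem_univ, true_and] at hp
    grind
  · intro j hj
    have hj' : j ≠ i := by simpa using hj
    rcases lt_or_gt_of_ne hj' with h | h
    · simp [min_eq_right h.le, h.ne]
    · simp [min_eq_left h.le, max_eq_right h.le]
  · rintro ⟨j, k⟩ hp
    simp only [upperPairs, Finset.mem_filter, Finset.mem_univ, true_and] at hp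
    by_cases hji : j = i
    · subst hji
      simp [hp.1.le]
    · have hki : k = i := by grind
      subst hki
      simp [hji, hp.1.le]
  · intro j hj
    rcases le_total i j with h | h
    · simp [h]
    · simp [h, hsymm i j]

lemma card_upperPairs_le : ((upperPairs r).card : ℝ) ≤ (r : ℝ) ^ 2 := by
  have h : (upperPairs r).card ≤ r * r := by
    simpa using Finset.card_le_univ (upperPairs r)
  calc ((upperPairs r).card : ℝ) ≤ ((r * r : ℕ) : ℝ) := by exact_mod_cast h
    _ = (r : ℝ) ^ 2 := by push_cast; ring

/-- The indicators `E i j` of the edges between the parts of a super-regular `r`-partite system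
with parts of size `n`, and their densities `D i j`; both are `1` on the diagonal. -/
structure IsSuperRegularSystem (E : Fin r → Fin r → Fin n → Fin n → ℝ) (D : Fin r → Fin r → ℝ)
    (d ε : ℝ) : Prop where
  zero_or_one : ∀ i j a b, E i j a b = 0 ∨ E i j a b = 1
  symm : ∀ i j a b, E i j a b = E j i b a
  diag : ∀ i a b, E i i a b = 1
  density_symm : ∀ i j, D i j = D j i
  density_diag : ∀ i, D i i = 1
  le_density : ∀ i j, d ≤ D i j
  density_le_one : ∀ i j, D i j ≤ 1
  cut : ∀ i j, i ≠ j → ∀ f g : Fin n → ℝ, (∀ a, f a = 0 ∨ f a = 1) → (∀ b, g b = 0 ∨ g b = 1) →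
    |∑ a, ∑ b, f a * g b * (E i j a b - D i j)| ≤ ε * (n : ℝ) ^ 2
  degree : ∀ i j a, (D i j - ε) * n ≤ ∑ b, E i j a b

/-- The indicator of the tuples that span a clique. -/
def cliqueIndicator (E : Fin r → Fin r → Fin n → Fin n → ℝ) (x : Fin r → Fin n) : ℝ :=
  ∏ p ∈ upperPairs r, E p.1 p.2 (x p.1) (x p.2)

lemma zero_or_one_mul {s t : ℝ} (hs : s = 0 ∨ s = 1) (ht : t = 0 ∨ t = 1) :
    s * t = 0 ∨ s * t = 1 := by
  rcases hs with rfl | rfl <;> simp [ht]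

lemma zero_or_one_prod {α : Type*} (s : Finset α) {f : α → ℝ} (hf : ∀ a, f a = 0 ∨ f a = 1) :
    ∏ a ∈ s, f a = 0 ∨ ∏ a ∈ s, f a = 1 :=
  Finset.prod_induction f (fun t => t = 0 ∨ t = 1) (fun _ _ => zero_or_one_mul) (Or.inr rfl)
    fun a _ => hf a

/-- A `{0, 1}`-valued function of tuples that splits as a product of a function not depending on
coordinate `a` and a function not depending on coordinate `b`. -/
def SplitsAt (a b : Fin r) (H : (Fin r → Fin n) → ℝ) : Prop :=
  ∃ H₁ H₂ : (Fin r → Fin n) → ℝ, (∀ x, H x = H₁ x * H₂ x) ∧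
    (∀ x, H₁ x = 0 ∨ H₁ x = 1) ∧ (∀ x, H₂ x = 0 ∨ H₂ x = 1) ∧
    (∀ x y, H₁ (Function.update x a y) = H₁ x) ∧ (∀ x y, H₂ (Function.update x b y) = H₂ x)

lemma SplitsAt.mul {a b : Fin r} {H K : (Fin r → Fin n) → ℝ} (hH : SplitsAt a b H)
    (hK : SplitsAt a b K) : SplitsAt a b (H * K) := by
  obtain ⟨H₁, H₂, h, h₁, h₂, u₁, u₂⟩ := hH
  obtain ⟨K₁, K₂, k, k₁, k₂, v₁, v₂⟩ := hK
  refine ⟨H₁ * K₁, H₂ * K₂, fun x => ?_, fun x => zero_or_one_mul (h₁ x) (k₁ x),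
    fun x => zero_or_one_mul (h₂ x) (k₂ x), fun x y => ?_, fun x y => ?_⟩
  · simp only [Pi.mul_apply, h, k]; ring
  · simp only [Pi.mul_apply, u₁, v₁]
  · simp only [Pi.mul_apply, u₂, v₂]

lemma splitsAt_of_left {a b : Fin r} {H : (Fin r → Fin n) → ℝ} (h : ∀ x, H x = 0 ∨ H x = 1)
    (ha : ∀ x y, H (Function.update x a y) = H x) : SplitsAt a b H :=
  ⟨H, 1, by simp, h, by simp, ha, by simp⟩

lemma splitsAt_of_right {a b : Fin r} {H : (Fin r → Fin n) → ℝ} (h : ∀ x, H x = 0 ∨ H x = 1)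
    (hb : ∀ x y, H (Function.update x b y) = H x) : SplitsAt a b H :=
  ⟨1, H, by simp, by simp, h, by simp, hb⟩

lemma splitsAt_prod {α : Type*} {a b : Fin r} (s : Finset α) (H : α → (Fin r → Fin n) → ℝ)
    (h : ∀ q ∈ s, SplitsAt a b (H q)) : SplitsAt a b (fun x => ∏ q ∈ s, H q x) := by
  have := Finset.prod_induction H (SplitsAt a b) (fun _ _ => SplitsAt.mul)
    (splitsAt_of_left (by simp) (by simp)) h
  convert this using 1
  ext x
  simp

lemma splitsAt_coord {a b i : Fin r} (hab : a ≠ b) {f : Fin n → ℝ} (hf : ∀ y, f y = 0 ∨ f y = 1) :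
    SplitsAt a b (fun x => f (x i)) := by
  by_cases hi : i = a
  · refine splitsAt_of_right (fun x => hf _) fun x y => ?_
    rw [Function.update_of_ne (hi.trans_ne hab)]
  · refine splitsAt_of_left (fun x => hf _) fun x y => ?_
    rw [Function.update_of_ne hi]

lemma IsSuperRegularSystem.abs_sum_mul_sub_le {E : Fin r → Fin r → Fin n → Fin n → ℝ}
    {D : Fin r → Fin r → ℝ} {d ε : ℝ} (hE : IsSuperRegularSystem E D d ε) (hn : 0 < n)
    {a b : Fin r} (hab : a ≠ b) {H : (Fin r → Fin n) → ℝ} (hH : SplitsAt a b H) :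
    |∑ x, H x * (E a b (x a) (x b) - D a b)| ≤ ε * (n : ℝ) ^ r := by
  obtain ⟨H₁, H₂, h, h₁, h₂, u₁, u₂⟩ := hH
  have hn' : (0 : ℝ) < n := by exact_mod_cast hn
  have key : ∀ x, |∑ y, ∑ z, H₂ (Function.update x a y) * H₁ (Function.update x b z) *
      (E a b y z - D a b)| ≤ ε * (n : ℝ) ^ 2 := fun x =>
    hE.cut a b hab _ _ (fun y => h₂ _) (fun z => h₁ _)
  have hsum : (n : ℝ) ^ 2 * ∑ x, H x * (E a b (x a) (x b) - D a b) =
      ∑ x, ∑ y, ∑ z, H₂ (Function.update x a y) * H₁ (Function.update x b z) *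
        (E a b y z - D a b) := by
    rw [pow_two, mul_assoc, ← sum_sum_update b, Finset.sum_comm, Finset.mul_sum]
    simp_rw [← sum_sum_update a]
    rw [Finset.sum_comm]
    refine Finset.sum_congr rfl fun x _ => ?_
    rw [Finset.sum_comm]
    refine Finset.sum_congr rfl fun y _ => Finset.sum_congr rfl fun z _ => ?_
    rw [h, u₂, Function.update_self, Function.update_of_ne hab, Function.update_self,
      Function.update_comm hab, u₁]
    ring
  have hle : |∑ x, ∑ y, ∑ z, H₂ (Function.update x a y) * H₁ (Function.update x b z) *
        (E a b y z - D a b)| ≤ (n : ℝ) ^ r * (ε * (n : ℝ) ^ 2) := by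
    refine (Finset.abs_sum_le_sum_abs _ _).trans ((Finset.sum_le_sum fun x _ => key x).trans ?_)
    simp
  rw [← hsum, abs_mul, abs_of_pos (by positivity)] at hle
  have : (0 : ℝ) < (n : ℝ) ^ 2 := by positivity
  nlinarith

/-- The counting lemma for a super-regular system. -/
lemma IsSuperRegularSystem.counting {E : Fin r → Fin r → Fin n → Fin n → ℝ}
    {D : Fin r → Fin r → ℝ} {d ε : ℝ} (hE : IsSuperRegularSystem E D d ε) (hd : 0 ≤ d)
    (hε : 0 ≤ ε) (hn : 0 < n) (S : Finset (Fin r × Fin r)) (hS : S ⊆ upperPairs r)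
    (φ : Fin r → Fin n → ℝ) (hφ : ∀ i a, φ i a = 0 ∨ φ i a = 1) :
    |∑ x : Fin r → Fin n, (∏ i, φ i (x i)) * ∏ p ∈ S, E p.1 p.2 (x p.1) (x p.2) -
      (∏ p ∈ S, D p.1 p.2) * ∏ i, ∑ a, φ i a| ≤ (r : ℝ) ^ 2 * ε * (n : ℝ) ^ r := by
  suffices h : |∑ x : Fin r → Fin n, (∏ i, φ i (x i)) * ∏ p ∈ S, E p.1 p.2 (x p.1) (x p.2) -
      (∏ p ∈ S, D p.1 p.2) * ∏ i, ∑ a, φ i a| ≤ S.card * (ε * (n : ℝ) ^ r) by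
    refine h.trans ?_
    rw [mul_assoc]
    gcongr
    refine le_trans ?_ (card_upperPairs_le (r := r))
    exact_mod_cast Finset.card_le_card hS
  induction S using Finset.induction_on with
  | empty =>
    simp [Finset.prod_univ_sum]
  | insert p S hp ih =>
    have hlt : ∀ q ∈ insert p S, q.1 < q.2 := fun q hq => by
      simpa [upperPairs] using hS hq
    have hpp : p.1 ≠ p.2 := (hlt p (Finset.mem_insert_self _ _)).ne
    have ih' := ih ((Finset.subset_insert p S).trans hS)
    have hsplit : SplitsAt p.1 p.2 (fun x : Fin r → Fin n =>
        (∏ i, φ i (x i)) * ∏ q ∈ S, E q.1 q.2 (x q.1) (x q.2)) := by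
      refine SplitsAt.mul (splitsAt_prod _ (fun i x => φ i (x i)) fun i _ =>
        splitsAt_coord hpp (hφ i)) (splitsAt_prod _
        (fun (q : Fin r × Fin r) x => E q.1 q.2 (x q.1) (x q.2)) ?_)
      intro q hq
      by_cases h1 : q.1 ≠ p.1 ∧ q.2 ≠ p.1
      · refine splitsAt_of_left (fun x => hE.zero_or_one _ _ _ _) fun x y => ?_
        rw [Function.update_of_ne h1.1, Function.update_of_ne h1.2]
      · have h2 : q.1 ≠ p.2 ∧ q.2 ≠ p.2 := by
          have e1 := hlt p (Finset.mem_insert_self _ _)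
          have e2 := hlt q (Finset.mem_insert_of_mem hq)
          have e3 : q ≠ p := fun h => hp (h ▸ hq)
          have e4 : ¬ (q.1 = p.1 ∧ q.2 = p.2) := fun h => e3 (Prod.ext h.1 h.2)
          grind
        refine splitsAt_of_right (fun x => hE.zero_or_one _ _ _ _) fun x y => ?_
        rw [Function.update_of_ne h2.1, Function.update_of_ne h2.2]
    have hstep := hE.abs_sum_mul_sub_le hn hpp hsplit
    have hD : |D p.1 p.2| ≤ 1 :=
      abs_le.2 ⟨by linarith [hE.le_density p.1 p.2], hE.density_le_one _ _⟩
    have hid : ∑ x : Fin r → Fin n,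
          (∏ i, φ i (x i)) * ∏ q ∈ insert p S, E q.1 q.2 (x q.1) (x q.2) -
          (∏ q ∈ insert p S, D q.1 q.2) * ∏ i, ∑ a, φ i a =
        ∑ x : Fin r → Fin n, (∏ i, φ i (x i)) * (∏ q ∈ S, E q.1 q.2 (x q.1) (x q.2)) *
          (E p.1 p.2 (x p.1) (x p.2) - D p.1 p.2) +
        D p.1 p.2 * (∑ x : Fin r → Fin n,
          (∏ i, φ i (x i)) * ∏ q ∈ S, E q.1 q.2 (x q.1) (x q.2) -
          (∏ q ∈ S, D q.1 q.2) * ∏ i, ∑ a, φ i a) := by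
      rw [mul_sub (D p.1 p.2), Finset.mul_sum, ← add_sub_assoc, ← Finset.sum_add_distrib,
        Finset.prod_insert hp, mul_assoc (D p.1 p.2)]
      congr 1
      refine Finset.sum_congr rfl fun x _ => ?_
      rw [Finset.prod_insert hp]
      ring
    rw [hid, Finset.card_insert_of_notMem hp]
    push_cast
    refine (abs_add_le _ _).trans ?_
    rw [abs_mul]
    have := mul_le_mul hD ih' (abs_nonneg _) zero_le_one
    linarith

lemma upperPairsAvoiding_subset (i : Fin r) : upperPairsAvoiding i ⊆ upperPairs r :=
  Finset.filter_subset _ _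

/-- The number of clique extensions common to the vertices `u` and `v` of part `i`, scaled by the
size of a part. -/
def commonExtensions (E : Fin r → Fin r → Fin n → Fin n → ℝ) (i : Fin r) (u v : Fin n) : ℝ :=
  ∑ x, cliqueIndicator E (Function.update x i u) * cliqueIndicator E (Function.update x i v)

lemma commonExtensions_comm (E : Fin r → Fin r → Fin n → Fin n → ℝ) (i : Fin r) (u v : Fin n) :
    commonExtensions E i u v = commonExtensions E i v u :=
  Finset.sum_congr rfl fun _ _ => mul_comm _ _

/-- The vertices `u` and `v` of part `i` have many common neighbours in every other part. -/
def HasLargeCodegree (E : Fin r → Fin r → Fin n → Fin n → ℝ) (d : ℝ) (i : Fin r)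
    (u v : Fin n) : Prop :=
  ∀ j, d ^ 2 / 4 * n ≤ ∑ y, E i j u y * E i j v y

lemma HasLargeCodegree.symm {E : Fin r → Fin r → Fin n → Fin n → ℝ} {d : ℝ} {i : Fin r}
    {u v : Fin n} (h : HasLargeCodegree E d i u v) : HasLargeCodegree E d i v u := fun j =>
  (h j).trans_eq (Finset.sum_congr rfl fun _ _ => mul_comm _ _)

lemma prod_sub_card_mul_le_prod_sub {α : Type*} (s : Finset α) (c : α → ℝ) {ε : ℝ} (hε : 0 ≤ ε)
    (hc : ∀ a ∈ s, ε ≤ c a) (hc1 : ∀ a ∈ s, c a ≤ 1) :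
    ∏ a ∈ s, c a - s.card * ε ≤ ∏ a ∈ s, (c a - ε) := by
  classical
  induction s using Finset.induction_on with
  | empty => simp
  | insert a s ha ih =>
    have ih' := ih (fun b hb => hc b (Finset.mem_insert_of_mem hb))
      fun b hb => hc1 b (Finset.mem_insert_of_mem hb)
    have h1 : ∏ b ∈ s, (c b - ε) ≤ 1 := Finset.prod_le_one
      (fun b hb => sub_nonneg.2 (hc b (Finset.mem_insert_of_mem hb)))
      fun b hb => by linarith [hc1 b (Finset.mem_insert_of_mem hb)]
    have hca := hc a (Finset.mem_insert_self _ _)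
    have hca1 := hc1 a (Finset.mem_insert_self _ _)
    rw [Finset.prod_insert ha, Finset.prod_insert ha, Finset.card_insert_of_notMem ha]
    push_cast
    have h2 := mul_le_mul_of_nonneg_left ih' (hε.trans hca)
    have h3 := mul_le_mul_of_nonneg_left h1 hε
    have h4 : c a * (s.card * ε) ≤ 1 * (s.card * ε) := by gcongr
    linarith

namespace IsSuperRegularSystem

variable {E : Fin r → Fin r → Fin n → Fin n → ℝ} {D : Fin r → Fin r → ℝ} {d ε : ℝ}

lemma nonneg (hE : IsSuperRegularSystem E D d ε) (i j : Fin r) (a b : Fin n) : 0 ≤ E i j a b := by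
  rcases hE.zero_or_one i j a b with h | h <;> simp [h]

lemma cliqueIndicator_zero_or_one (hE : IsSuperRegularSystem E D d ε) (x : Fin r → Fin n) :
    cliqueIndicator E x = 0 ∨ cliqueIndicator E x = 1 :=
  zero_or_one_prod _ fun _ => hE.zero_or_one _ _ _ _

lemma cliqueIndicator_nonneg (hE : IsSuperRegularSystem E D d ε) (x : Fin r → Fin n) :
    0 ≤ cliqueIndicator E x := by
  rcases hE.cliqueIndicator_zero_or_one x with h | h <;> simp [h]

lemma cliqueIndicator_le_one (hE : IsSuperRegularSystem E D d ε) (x : Fin r → Fin n) :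
    cliqueIndicator E x ≤ 1 := by
  rcases hE.cliqueIndicator_zero_or_one x with h | h <;> simp [h]

lemma cliqueIndicator_update (hE : IsSuperRegularSystem E D d ε) (x : Fin r → Fin n) (i : Fin r)
    (a : Fin n) :
    cliqueIndicator E (Function.update x i a) = (∏ j, E i j a (x j)) *
      ∏ p ∈ upperPairsAvoiding i, E p.1 p.2 (x p.1) (x p.2) := by
  rw [cliqueIndicator, prod_upperPairs i
    (fun j k => E j k (Function.update x i a j) (Function.update x i a k))
    (fun j k => hE.symm _ _ _ _) (hE.diag _ _ _)]
  congr 1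
  · refine Finset.prod_congr rfl fun j _ => ?_
    by_cases hj : j = i
    · subst hj
      rw [hE.diag, hE.diag]
    · rw [Function.update_self, Function.update_of_ne hj]
  · refine Finset.prod_congr rfl fun p hp => ?_
    have hp' := (Finset.mem_filter.1 hp).2
    rw [Function.update_of_ne hp'.1, Function.update_of_ne hp'.2]

lemma prod_density_nonneg (hE : IsSuperRegularSystem E D d ε) (hd : 0 ≤ d)
    (S : Finset (Fin r × Fin r)) : 0 ≤ ∏ p ∈ S, D p.1 p.2 :=
  Finset.prod_nonneg fun _ _ => hd.trans (hE.le_density _ _)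

lemma prod_density_le_one (hE : IsSuperRegularSystem E D d ε) (hd : 0 ≤ d)
    (S : Finset (Fin r × Fin r)) : ∏ p ∈ S, D p.1 p.2 ≤ 1 :=
  Finset.prod_le_one (fun _ _ => hd.trans (hE.le_density _ _)) fun _ _ => hE.density_le_one _ _

lemma pow_le_prod_density (hE : IsSuperRegularSystem E D d ε) (hd : 0 ≤ d) (hd1 : d ≤ 1)
    {S : Finset (Fin r × Fin r)} (hS : S ⊆ upperPairs r) :
    d ^ r ^ 2 ≤ ∏ p ∈ S, D p.1 p.2 := by
  have hcard : S.card ≤ r ^ 2 := by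
    have : ((upperPairs r).card : ℝ) ≤ ((r ^ 2 : ℕ) : ℝ) := by
      exact_mod_cast card_upperPairs_le (r := r)
    exact (Finset.card_le_card hS).trans (by exact_mod_cast this)
  calc d ^ r ^ 2 ≤ d ^ S.card := pow_le_pow_of_le_one hd hd1 hcard
    _ = ∏ p ∈ S, d := by simp
    _ ≤ ∏ p ∈ S, D p.1 p.2 := Finset.prod_le_prod (fun _ _ => hd) fun _ _ => hE.le_density _ _

lemma sum_cliqueIndicator_update_ge (hE : IsSuperRegularSystem E D d ε) (hd : 0 ≤ d)
    (hε : 0 ≤ ε) (hεd : ε ≤ d) (hn : 0 < n) (i : Fin r) (a : Fin n) :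
    (∏ p ∈ upperPairs r, D p.1 p.2 - ((r : ℝ) ^ 2 + r) * ε) * (n : ℝ) ^ r ≤
      ∑ x, cliqueIndicator E (Function.update x i a) := by
  have h := abs_le.1 (hE.counting hd hε hn (upperPairsAvoiding i) (upperPairsAvoiding_subset i)
    (fun j => E i j a) fun j => hE.zero_or_one i j a)
  simp_rw [hE.cliqueIndicator_update]
  have hP := prod_upperPairs i D hE.density_symm (hE.density_diag i)
  have h0 := hE.prod_density_nonneg hd (upperPairsAvoiding i)
  have h1 := hE.prod_density_le_one hd (upperPairsAvoiding i)
  have hprod : (∏ j, D i j - r * ε) * (n : ℝ) ^ r ≤ ∏ j, ∑ b, E i j a b :=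
    calc (∏ j, D i j - r * ε) * (n : ℝ) ^ r ≤ (∏ j, (D i j - ε)) * (n : ℝ) ^ r := by
          gcongr
          simpa using prod_sub_card_mul_le_prod_sub Finset.univ (D i) hε
            (fun j _ => hεd.trans (hE.le_density _ _)) fun j _ => hE.density_le_one _ _
      _ = ∏ j, ((D i j - ε) * n) := by simp [Finset.prod_mul_distrib]
      _ ≤ ∏ j, ∑ b, E i j a b := Finset.prod_le_prod (fun j _ => mul_nonneg
          (sub_nonneg.2 (hεd.trans (hE.le_density _ _))) (Nat.cast_nonneg n))
          fun j _ => hE.degree i j a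
  have h2 := mul_le_mul_of_nonneg_left hprod h0
  have h3 : (∏ p ∈ upperPairsAvoiding i, D p.1 p.2) * (r * ε * (n : ℝ) ^ r) ≤
      1 * (r * ε * (n : ℝ) ^ r) := by gcongr
  rw [hP]
  linarith [h.1]

lemma sum_cliqueIndicator_le (hE : IsSuperRegularSystem E D d ε) (hd : 0 ≤ d)
    (hε : 0 ≤ ε) (hn : 0 < n) :
    ∑ x, cliqueIndicator E x ≤
      (∏ p ∈ upperPairs r, D p.1 p.2 + (r : ℝ) ^ 2 * ε) * (n : ℝ) ^ r := by
  have h := (abs_le.1 (hE.counting hd hε hn (upperPairs r) subset_rfl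
    (fun _ _ => 1) fun _ _ => Or.inr rfl)).2
  simp only [Finset.prod_const_one, one_mul, Finset.sum_const, Finset.card_univ, Fintype.card_fin,
    nsmul_eq_mul, mul_one, Finset.prod_const] at h
  unfold cliqueIndicator
  linarith

lemma card_not_hasLargeCodegree_le (hE : IsSuperRegularSystem E D d ε) (hd : 0 < d)
    (hεd : ε ≤ d / 2) (hn : 0 < n) (i : Fin r) (u : Fin n)
    [DecidablePred fun v => HasLargeCodegree E d i u v] (hd1 : d ≤ 1) (hε : 0 ≤ ε) :
    (((Finset.univ.filter fun v => ¬ HasLargeCodegree E d i u v).card : ℕ) : ℝ) ≤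
      r * (4 * ε / d ^ 2) * n := by
  classical
  have hn' : (0 : ℝ) < n := by exact_mod_cast hn
  let B : Fin r → Finset (Fin n) := fun j =>
    Finset.univ.filter fun v => ¬ d ^ 2 / 4 * n ≤ ∑ y, E i j u y * E i j v y
  have hB : ∀ j, ((B j).card : ℝ) ≤ 4 * ε / d ^ 2 * n := by
    intro j
    by_cases hij : i = j
    · subst hij
      have : B i = ∅ := by
        refine Finset.filter_eq_empty_iff.2 fun v _ => not_not.2 ?_
        simp only [hE.diag, mul_one, Finset.sum_const, Finset.card_univ, Fintype.card_fin,
          nsmul_eq_mul]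
        have : d ^ 2 / 4 ≤ 1 := by nlinarith
        nlinarith
      rw [this]
      simp only [Finset.card_empty, Nat.cast_zero]
      positivity
    have hcut := (abs_le.1 (hE.cut i j hij (fun v => if v ∈ B j then 1 else 0) (E i j u)
      (fun v => by split_ifs <;> simp) (hE.zero_or_one i j u))).1
    have hid : ∑ v, ∑ y, (if v ∈ B j then (1 : ℝ) else 0) * E i j u y * (E i j v y - D i j) =
        ∑ v ∈ B j, (∑ y, E i j u y * E i j v y - D i j * ∑ y, E i j u y) := by
      rw [← Finset.sum_filter_add_sum_filter_not Finset.univ (fun v => v ∈ B j),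
        Finset.sum_eq_zero (s := Finset.univ.filter fun v => ¬ v ∈ B j), add_zero,
        Finset.filter_mem_eq_inter, Finset.univ_inter]
      · refine Finset.sum_congr rfl fun v hv => ?_
        rw [Finset.mul_sum, ← Finset.sum_sub_distrib]
        refine Finset.sum_congr rfl fun y _ => ?_
        rw [if_pos hv]
        ring
      · intro v hv
        simp [(Finset.mem_filter.1 hv).2]
    have hterm : ∑ v ∈ B j, (∑ y, E i j u y * E i j v y - D i j * ∑ y, E i j u y) ≤
        ∑ v ∈ B j, (-(d ^ 2 / 4 * n)) := by
      refine Finset.sum_le_sum fun v hv => ?_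
      have h1 : ∑ y, E i j u y * E i j v y < d ^ 2 / 4 * n := not_le.1 (Finset.mem_filter.1 hv).2
      have h2 := hE.degree i j u
      have h3 := hE.le_density i j
      have h4 : d * (d / 2 * n) ≤ D i j * ∑ y, E i j u y := by
        refine mul_le_mul h3 (le_trans ?_ h2) (by positivity) (by linarith)
        gcongr
        linarith
      linarith
    rw [hid] at hcut
    have h5 := hcut.trans hterm
    rw [Finset.sum_const, nsmul_eq_mul] at h5
    have h6 : ((B j).card * (d ^ 2 / 4)) * n ≤ (ε * n) * n := by linarith
    have h7 := le_of_mul_le_mul_right h6 hn'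
    rw [div_mul_eq_mul_div, le_div_iff₀ (by positivity)]
    linarith
  have hsub : (Finset.univ.filter fun v => ¬ HasLargeCodegree E d i u v) ⊆
      Finset.univ.biUnion B := by
    intro v hv
    have := (Finset.mem_filter.1 hv).2
    unfold HasLargeCodegree at this
    push Not at this
    obtain ⟨j, hj⟩ := this
    exact Finset.mem_biUnion.2 ⟨j, Finset.mem_univ _, Finset.mem_filter.2
      ⟨Finset.mem_univ _, not_le.2 hj⟩⟩
  calc (((Finset.univ.filter fun v => ¬ HasLargeCodegree E d i u v).card : ℕ) : ℝ)
      ≤ ∑ j, ((B j).card : ℝ) := by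
        exact_mod_cast (Finset.card_le_card hsub).trans Finset.card_biUnion_le
    _ ≤ ∑ _j : Fin r, 4 * ε / d ^ 2 * n := Finset.sum_le_sum fun j _ => hB j
    _ = r * (4 * ε / d ^ 2) * n := by simp; ring

lemma commonExtensions_ge (hE : IsSuperRegularSystem E D d ε) (hd : 0 < d) (hd1 : d ≤ 1)
    (hε : 0 ≤ ε) (hn : 0 < n) {i : Fin r} {u v : Fin n} (huv : HasLargeCodegree E d i u v) :
    (d ^ r ^ 2 * (d ^ 2 / 4) ^ r - (r : ℝ) ^ 2 * ε) * (n : ℝ) ^ r ≤ commonExtensions E i u v := by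
  have h := (abs_le.1 (hE.counting hd.le hε hn (upperPairsAvoiding i)
    (upperPairsAvoiding_subset i) (fun j y => E i j u y * E i j v y)
    fun j y => zero_or_one_mul (hE.zero_or_one i j u y) (hE.zero_or_one i j v y))).1
  have hid : commonExtensions E i u v = ∑ x : Fin r → Fin n,
      (∏ j, E i j u (x j) * E i j v (x j)) *
        ∏ p ∈ upperPairsAvoiding i, E p.1 p.2 (x p.1) (x p.2) := by
    refine Finset.sum_congr rfl fun x _ => ?_
    rw [hE.cliqueIndicator_update, hE.cliqueIndicator_update, Finset.prod_mul_distrib]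
    have := zero_or_one_prod (upperPairsAvoiding i) (f := fun p => E p.1 p.2 (x p.1) (x p.2))
      fun p => hE.zero_or_one _ _ _ _
    rcases this with h | h <;> simp [h]
  have h1 : (d ^ 2 / 4 * n) ^ r ≤ ∏ j, ∑ y, E i j u y * E i j v y := by
    calc (d ^ 2 / 4 * n) ^ r = ∏ _j : Fin r, (d ^ 2 / 4 * n) := by simp
      _ ≤ _ := Finset.prod_le_prod (fun j _ => by positivity) fun j _ => huv j
  have h2 := mul_le_mul (hE.pow_le_prod_density hd.le hd1 (upperPairsAvoiding_subset i)) h1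
    (by positivity) (hE.prod_density_nonneg hd.le _)
  rw [hid]
  rw [mul_pow] at h2
  linarith

end IsSuperRegularSystem

lemma exists_norm_le_of_norm_sub_le {W : Type*} [NormedAddCommGroup W] [NormedSpace ℝ W]
    [FiniteDimensional ℝ W] (T : W →ₗ[ℝ] W) (h : ∀ p, ‖p - T p‖ ≤ ‖p‖ / 2) (e : W) :
    ∃ p, T p = e ∧ ‖p‖ ≤ 2 * ‖e‖ := by
  have hle : ∀ p, ‖p‖ ≤ 2 * ‖T p‖ := fun p => by
    have h1 := norm_add_le (p - T p) (T p)
    rw [sub_add_cancel] at h1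
    linarith [h p]
  have hinj : Function.Injective T := by
    refine (injective_iff_map_eq_zero T).2 fun p hp => ?_
    have := hle p
    rw [hp, norm_zero, mul_zero] at this
    exact norm_le_zero_iff.1 this
  obtain ⟨p, hp⟩ := LinearMap.injective_iff_surjective.1 hinj e
  exact ⟨p, hp, hp ▸ hle p⟩

lemma sum_sum_eq_zero_of_antisymm (F : Fin n → Fin n → ℝ) (hF : ∀ u v, F u v = -F v u) :
    ∑ u, ∑ v, F u v = 0 := by
  have h : ∑ u, ∑ v, F u v = -∑ u, ∑ v, F u v := by
    conv_lhs => rw [Finset.sum_comm]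
    simp_rw [← Finset.sum_neg_distrib]
    exact Finset.sum_congr rfl fun u _ => Finset.sum_congr rfl fun v _ => hF v u
  linarith

/-- In an almost complete graph, any demand on the vertices is met, up to a constant, by a flow of
comparable size. -/
lemma exists_flow (hn : 0 < n) (R : Fin n → Fin n → Prop) [∀ u, DecidablePred (R u)]
    (hR : ∀ u v, R u v → R v u)
    (hbad : ∀ u, ((Finset.univ.filter fun v => ¬ R u v).card : ℝ) ≤ 1 / 4 * n)
    (e : Fin n → ℝ) {η : ℝ} (he : ∀ u, |e u| ≤ η) :
    ∃ F : Fin n → Fin n → ℝ, (∀ u v, F u v = -F v u) ∧ (∀ u v, ¬ R u v → F u v = 0) ∧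
      (∀ u v, |F u v| ≤ 4 * η / n) ∧ ∀ u, ∑ v, F u v = e u - (∑ v, e v) / n := by
  have hn' : (0 : ℝ) < n := by exact_mod_cast hn
  have hη : 0 ≤ η := (abs_nonneg _).trans (he ⟨0, hn⟩)
  let T : (Fin n → ℝ) →ₗ[ℝ] (Fin n → ℝ) :=
    { toFun := fun p u => p u - (∑ v ∈ Finset.univ.filter (fun v => ¬ R u v), (p u - p v)) / n
      map_add' := fun p q => by
        ext u
        simp only [Pi.add_apply, add_sub_add_comm, Finset.sum_add_distrib]
        ring
      map_smul' := fun c p => by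
        ext u
        simp only [Pi.smul_apply, smul_eq_mul, ← mul_sub, ← Finset.mul_sum, RingHom.id_apply]
        ring }
  have hdiff : ∀ (p : Fin n → ℝ) u v, |p u - p v| ≤ 2 * ‖p‖ := fun p u v => by
    have h1 := abs_sub (p u) (p v)
    have h2 := norm_le_pi_norm p u
    have h3 := norm_le_pi_norm p v
    rw [Real.norm_eq_abs] at h2 h3
    linarith
  have hT : ∀ p, ‖p - T p‖ ≤ ‖p‖ / 2 := by
    intro p
    refine (pi_norm_le_iff_of_nonneg (by positivity)).2 fun u => ?_
    have hval : (p - T p) u =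
        (∑ v ∈ Finset.univ.filter (fun v => ¬ R u v), (p u - p v)) / n := by
      simp [T]
    rw [hval, Real.norm_eq_abs, abs_div, abs_of_pos hn', div_le_iff₀ hn']
    refine (Finset.abs_sum_le_sum_abs _ _).trans
      ((Finset.sum_le_sum fun v _ => hdiff p u v).trans ?_)
    rw [Finset.sum_const, nsmul_eq_mul]
    have := mul_le_mul_of_nonneg_right (hbad u) (by positivity : 0 ≤ 2 * ‖p‖)
    linarith
  obtain ⟨p, hp, hpe⟩ := exists_norm_le_of_norm_sub_le T hT e
  have heη : ‖e‖ ≤ η := (pi_norm_le_iff_of_nonneg hη).2 he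
  let F : Fin n → Fin n → ℝ := fun u v => if R u v then (p u - p v) / n else 0
  have hanti : ∀ u v, F u v = -F v u := fun u v => by
    by_cases h : R u v
    · simp only [F, if_pos h, if_pos (hR _ _ h)]
      ring
    · simp only [F, if_neg h, if_neg (fun h' => h (hR _ _ h')), neg_zero]
  have hrow : ∀ u, ∑ v, F u v = e u - (∑ v, p v) / n := fun u => by
    have h1 : e u = p u - (∑ v ∈ Finset.univ.filter (fun v => ¬ R u v), (p u - p v)) / n := by
      rw [← hp]; rfl
    have h2 : ∑ v, F u v = (∑ v ∈ Finset.univ.filter (fun v => R u v), (p u - p v)) / n := by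
      rw [Finset.sum_div, Finset.sum_filter]
    have h3 := Finset.sum_filter_add_sum_filter_not Finset.univ (fun v => R u v)
      (fun v => p u - p v)
    rw [Finset.sum_sub_distrib (s := Finset.univ)] at h3
    simp only [Finset.sum_const, Finset.card_univ, Fintype.card_fin, nsmul_eq_mul] at h3
    rw [h1, h2]
    field_simp
    linarith
  have htotal : ∑ u, ∑ v, F u v = 0 := sum_sum_eq_zero_of_antisymm F hanti
  have hmean : ∑ v, p v = ∑ v, e v := by
    simp_rw [hrow] at htotal
    rw [Finset.sum_sub_distrib] at htotal
    simp only [Finset.sum_const, Finset.card_univ, Fintype.card_fin, nsmul_eq_mul] at htotal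
    field_simp at htotal
    linarith
  refine ⟨F, hanti, fun u v h => if_neg h, fun u v => ?_, fun u => hmean ▸ hrow u⟩
  by_cases h : R u v
  · simp only [F, if_pos h]
    rw [abs_div, abs_of_pos hn']
    gcongr
    linarith [hdiff p u v]
  · simp only [F, if_neg h, abs_zero]
    positivity

namespace IsSuperRegularSystem

variable {E : Fin r → Fin r → Fin n → Fin n → ℝ} {D : Fin r → Fin r → ℝ} {d ε : ℝ}

/-- A flow between the vertices of part `i` is realised by moving weight between cliques that
differ only in part `i`; this does not affect the vertices of the other parts. -/
lemma exists_weight_of_flow (hE : IsSuperRegularSystem E D d ε) (hn : 0 < n) {μ η : ℝ} (hμ : 0 < μ)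
    (hη : 0 ≤ η) (i : Fin r) (F : Fin n → Fin n → ℝ) (hanti : ∀ u v, F u v = -F v u)
    (hF : ∀ u v, |F u v| ≤ η * (n : ℝ) ^ r / n)
    (hM : ∀ u v, F u v ≠ 0 → μ * (n : ℝ) ^ r ≤ commonExtensions E i u v) :
    ∃ τ : (Fin r → Fin n) → ℝ, (∀ x, |τ x| ≤ η / μ) ∧
      (∀ a, ∑ x, cliqueIndicator E (Function.update x i a) * τ (Function.update x i a) =
        ∑ v, F a v) ∧
      ∀ j, j ≠ i → ∀ b,
        ∑ x, cliqueIndicator E (Function.update x j b) * τ (Function.update x j b) = 0 := by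
  have hn' : (0 : ℝ) < n := by exact_mod_cast hn
  have hQ : (0 : ℝ) < (n : ℝ) ^ r := by positivity
  refine ⟨fun x => ∑ v, F (x i) v * cliqueIndicator E (Function.update x i v) /
    commonExtensions E i (x i) v, fun x => ?_, fun a => ?_, fun j hj b => ?_⟩
  · have hterm : ∀ v, |F (x i) v * cliqueIndicator E (Function.update x i v) /
        commonExtensions E i (x i) v| ≤ η / μ / n := by
      intro v
      by_cases h0 : F (x i) v = 0
      · rw [h0]
        simp only [zero_mul, zero_div, abs_zero]
        positivity
      have hM' := hM _ _ h0
      have hpos : 0 < commonExtensions E i (x i) v := lt_of_lt_of_le (by positivity) hM'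
      rw [abs_div, abs_mul, abs_of_pos hpos, abs_of_nonneg (hE.cliqueIndicator_nonneg _)]
      calc |F (x i) v| * cliqueIndicator E (Function.update x i v) / commonExtensions E i (x i) v
          ≤ η * (n : ℝ) ^ r / n * 1 / (μ * (n : ℝ) ^ r) := by
            gcongr
            · exact hE.cliqueIndicator_nonneg _
            · exact hF _ _
            · exact hE.cliqueIndicator_le_one _
        _ = η / μ / n := by field_simp
    refine (Finset.abs_sum_le_sum_abs _ _).trans ((Finset.sum_le_sum fun v _ => hterm v).trans ?_)
    rw [Finset.sum_const, Finset.card_univ, Fintype.card_fin, nsmul_eq_mul]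
    exact (mul_div_cancel₀ _ hn'.ne').le
  · simp only [Function.update_self, Function.update_idem, Finset.mul_sum]
    rw [Finset.sum_comm]
    refine Finset.sum_congr rfl fun v _ => ?_
    by_cases h0 : F a v = 0
    · simp [h0]
    have hpos : 0 < commonExtensions E i a v := lt_of_lt_of_le (by positivity) (hM _ _ h0)
    calc _ = ∑ x, F a v / commonExtensions E i a v * (cliqueIndicator E (Function.update x i a) *
          cliqueIndicator E (Function.update x i v)) :=
          Finset.sum_congr rfl fun x _ => by ring
      _ = F a v := by
          rw [← Finset.mul_sum]
          exact div_mul_cancel₀ _ hpos.ne'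
  · refine (mul_eq_zero.1 ?_).resolve_left hn'.ne'
    rw [← sum_sum_update i]
    refine Finset.sum_eq_zero fun x _ => ?_
    simp only [Function.update_comm hj.symm, Function.update_self, Function.update_idem,
      Finset.mul_sum]
    set c : Fin n → ℝ := fun u => cliqueIndicator E (Function.update (Function.update x j b) i u)
    refine sum_sum_eq_zero_of_antisymm
      (fun u v => c u * (F u v * c v / commonExtensions E i u v)) fun u v => ?_
    rw [hanti u v, commonExtensions_comm]
    ring

lemma exists_correction (hE : IsSuperRegularSystem E D d ε) (hd : 0 < d) (hd1 : d ≤ 1)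
    (hε : 0 ≤ ε) (hεd : ε ≤ d / 2) (hn : 0 < n) (hbad : r * (4 * ε / d ^ 2) ≤ 1 / 4) {μ δ : ℝ}
    (hμ : 0 < μ) (hμε : μ ≤ d ^ r ^ 2 * (d ^ 2 / 4) ^ r - (r : ℝ) ^ 2 * ε) (hδ : 0 ≤ δ)
    (e : Fin r → Fin n → ℝ) (he : ∀ i a, |e i a| ≤ δ * (n : ℝ) ^ r) :
    ∃ τ : (Fin r → Fin n) → ℝ, (∀ x, |τ x| ≤ r * (4 * δ / μ)) ∧
      ∀ i a, ∑ x, cliqueIndicator E (Function.update x i a) * τ (Function.update x i a) =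
        e i a - (∑ b, e i b) / n := by
  classical
  have hflow : ∀ i, ∃ τ : (Fin r → Fin n) → ℝ, (∀ x, |τ x| ≤ 4 * δ / μ) ∧
      (∀ a, ∑ x, cliqueIndicator E (Function.update x i a) * τ (Function.update x i a) =
        e i a - (∑ b, e i b) / n) ∧
      ∀ j, j ≠ i → ∀ b,
        ∑ x, cliqueIndicator E (Function.update x j b) * τ (Function.update x j b) = 0 := by
    intro i
    obtain ⟨F, hanti, hsupp, hF, hrow⟩ := exists_flow hn (HasLargeCodegree E d i)
      (fun _ _ h => h.symm) (fun u => (hE.card_not_hasLargeCodegree_le hd hεd hn i u hd1 hε).trans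
        (by gcongr)) (e i) (he i)
    obtain ⟨τ, h1, h2, h3⟩ := hE.exists_weight_of_flow hn hμ (by positivity : 0 ≤ 4 * δ) i F hanti
      (fun u v => by rw [mul_assoc]; exact hF u v) fun u v h =>
        le_trans (by gcongr) (hE.commonExtensions_ge hd hd1 hε hn
          (not_not.1 fun h' => h (hsupp u v h')))
    exact ⟨τ, h1, fun a => (h2 a).trans (hrow a), h3⟩
  choose τ h1 h2 h3 using hflow
  refine ⟨fun x => ∑ i, τ i x, fun x => ?_, fun i a => ?_⟩
  · refine (Finset.abs_sum_le_sum_abs _ _).trans ((Finset.sum_le_sum fun i _ => h1 i x).trans ?_)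
    simp
  · simp only [Finset.mul_sum]
    rw [Finset.sum_comm, Finset.sum_eq_single i]
    · exact h2 i a
    · exact fun j _ hj => h3 j i hj.symm a
    · simp

end IsSuperRegularSystem

lemma one_sub_sum_le_prod {α : Type*} (s : Finset α) (c : α → ℝ) (h0 : ∀ a, 0 ≤ c a)
    (h1 : ∀ a, c a ≤ 1) : 1 - ∑ a ∈ s, (1 - c a) ≤ ∏ a ∈ s, c a := by
  classical
  induction s using Finset.induction_on with
  | empty => simp
  | insert a s ha ih =>
    rw [Finset.sum_insert ha, Finset.prod_insert ha]
    have h2 : ∏ b ∈ s, c b ≤ 1 := Finset.prod_le_one (fun b _ => h0 b) fun b _ => h1 b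
    nlinarith [h0 a, h1 a]

namespace IsSuperRegularSystem

variable {E : Fin r → Fin r → Fin n → Fin n → ℝ} {D : Fin r → Fin r → ℝ} {d ε : ℝ}

/-- A weighting of the cliques that is bounded below and almost perfect. -/
lemma exists_almost_perfect (hE : IsSuperRegularSystem E D d ε) (hd : 0 < d) (hε : 0 ≤ ε)
    (hεd : ε ≤ d) (hn : 0 < n) {P δ : ℝ} (hP : P = ∏ p ∈ upperPairs r, D p.1 p.2)
    (hP0 : 0 < P)
    (hδ : ((r : ℝ) ^ 2 + r) * ε + r * ((2 * (r : ℝ) ^ 2 + r) * ε / P) ≤ δ) :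
    ∃ ω : (Fin r → Fin n) → ℝ, (∀ x, P ^ r / 2 ≤ ω x ∧ ω x ≤ 1 / 2) ∧
      ∀ i a, |P / 2 * (n : ℝ) ^ r -
        ∑ x, cliqueIndicator E (Function.update x i a) * ω (Function.update x i a)| ≤
          δ * (n : ℝ) ^ r := by
  have hn' : (0 : ℝ) < n := by exact_mod_cast hn
  have hP1 : P ≤ 1 := hP ▸ hE.prod_density_le_one hd.le _
  set Q : ℝ := (n : ℝ) ^ r with hQdef
  have hQ : 0 < Q := by positivity
  let N : Fin r → Fin n → ℝ := fun i a => ∑ x, cliqueIndicator E (Function.update x i a)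
  have hNge : ∀ i a, (P - ((r : ℝ) ^ 2 + r) * ε) * Q ≤ N i a := fun i a => by
    rw [hP]
    exact hE.sum_cliqueIndicator_update_ge hd.le hε hεd hn i a
  have hNle : ∀ i a, N i a ≤ Q := fun i a => by
    refine (Finset.sum_le_sum fun x _ => hE.cliqueIndicator_le_one _).trans ?_
    simp [hQdef]
  have hNsum : ∀ i, ∑ a, N i a ≤ n * ((P + (r : ℝ) ^ 2 * ε) * Q) := fun i => by
    rw [Finset.sum_comm, sum_sum_update, hP]
    exact mul_le_mul_of_nonneg_left (hE.sum_cliqueIndicator_le hd.le hε hn) hn'.le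
  let m : Fin r → Fin n → ℝ := fun i a => max (N i a) (P * Q)
  have hm : ∀ i a, 0 < m i a := fun i a => lt_max_of_lt_right (by positivity)
  let lam : Fin r → Fin n → ℝ := fun i a => P * Q / m i a
  have hlam0 : ∀ i a, 0 ≤ lam i a := fun i a => div_nonneg (by positivity) (hm i a).le
  have hlam1 : ∀ i a, lam i a ≤ 1 := fun i a => (div_le_one (hm i a)).2 (le_max_right _ _)
  have hlamP : ∀ i a, P ≤ lam i a := fun i a => by
    rw [le_div_iff₀ (hm i a)]
    have : m i a ≤ Q := max_le (hNle i a) (by nlinarith)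
    gcongr
  have hlamN : ∀ i a, lam i a * N i a ≤ P * Q := fun i a => by
    rw [div_mul_eq_mul_div, div_le_iff₀ (hm i a)]
    gcongr
    exact le_max_left _ _
  have hlamN' : ∀ i a, (P - ((r : ℝ) ^ 2 + r) * ε) * Q ≤ lam i a * N i a := fun i a => by
    rcases le_total (N i a) (P * Q) with h | h
    · have : lam i a = 1 := by
        simp only [lam, m, max_eq_right h]
        exact div_self (by positivity)
      rw [this, one_mul]
      exact hNge i a
    · have h0 : 0 < N i a := lt_of_lt_of_le (by positivity) h
      have : lam i a * N i a = P * Q := by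
        simp only [lam, m, max_eq_left h]
        exact div_mul_cancel₀ _ h0.ne'
      rw [this]
      have : 0 ≤ ((r : ℝ) ^ 2 + r) * ε * Q := by positivity
      linarith
  have hdef : ∀ i a, 1 - lam i a ≤ (N i a - (P - ((r : ℝ) ^ 2 + r) * ε) * Q) / (P * Q) := by
    intro i a
    have h1 : 1 - lam i a = (m i a - P * Q) / m i a := by
      rw [sub_div, div_self (hm i a).ne']
    have h2 : m i a - P * Q ≤ N i a - (P - ((r : ℝ) ^ 2 + r) * ε) * Q := by
      rw [sub_le_iff_le_add]
      have : 0 ≤ ((r : ℝ) ^ 2 + r) * ε * Q := by positivity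
      exact max_le (by linarith) (by linarith [hNge i a])
    rw [h1]
    exact div_le_div₀ (sub_nonneg.2 (hNge i a)) h2 (by positivity) (le_max_right _ _)
  have hdefsum : ∀ i, ∑ a, (1 - lam i a) ≤ n * ((2 * (r : ℝ) ^ 2 + r) * ε / P) := by
    intro i
    refine (Finset.sum_le_sum fun a _ => hdef i a).trans ?_
    rw [← Finset.sum_div, Finset.sum_sub_distrib, Finset.sum_const, Finset.card_univ,
      Fintype.card_fin, nsmul_eq_mul, div_le_iff₀ (by positivity)]
    have : n * ((2 * (r : ℝ) ^ 2 + r) * ε / P) * (P * Q) =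
        n * ((2 * (r : ℝ) ^ 2 + r) * ε) * Q := by field_simp
    rw [this]
    linarith [hNsum i]
  have hcoord : ∀ j, ∑ x : Fin r → Fin n, (1 - lam j (x j)) ≤
      (2 * (r : ℝ) ^ 2 + r) * ε / P * Q := fun j => by
    have h1 := sum_apply_coord j fun a => 1 - lam j a
    have h2 := mul_le_mul_of_nonneg_left (hdefsum j) hQ.le
    rw [← h1] at h2
    exact le_of_mul_le_mul_left (by linarith) hn'
  refine ⟨fun x => (∏ j, lam j (x j)) / 2, fun x => ⟨?_, ?_⟩, fun i a => ?_⟩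
  · have : P ^ r ≤ ∏ j, lam j (x j) := by
      calc P ^ r = ∏ _j : Fin r, P := by simp
        _ ≤ _ := Finset.prod_le_prod (fun _ _ => hP0.le) fun j _ => hlamP _ _
    linarith
  · have : ∏ j, lam j (x j) ≤ 1 := Finset.prod_le_one (fun _ _ => hlam0 _ _) fun _ _ => hlam1 _ _
    linarith
  · have hup : ∀ x : Fin r → Fin n, ∏ j, lam j (Function.update x i a j) ≤ lam i a := fun x => by
      rw [← Finset.mul_prod_erase Finset.univ _ (Finset.mem_univ i), Function.update_self]
      exact mul_le_of_le_one_right (hlam0 _ _)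
        (Finset.prod_le_one (fun _ _ => hlam0 _ _) fun _ _ => hlam1 _ _)
    have hlow : ∀ x : Fin r → Fin n, lam i a - ∑ j, (1 - lam j (x j)) ≤
        ∏ j, lam j (Function.update x i a j) := fun x => by
      rw [← Finset.mul_prod_erase Finset.univ _ (Finset.mem_univ i), Function.update_self]
      have h1 : ∏ j ∈ Finset.univ.erase i, lam j (Function.update x i a j) =
          ∏ j ∈ Finset.univ.erase i, lam j (x j) := Finset.prod_congr rfl fun j hj => by
        rw [Function.update_of_ne (Finset.ne_of_mem_erase hj)]
      have h2 := one_sub_sum_le_prod (Finset.univ.erase i) (fun j => lam j (x j))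
        (fun _ => hlam0 _ _) fun _ => hlam1 _ _
      have h3 : ∑ j ∈ Finset.univ.erase i, (1 - lam j (x j)) ≤ ∑ j, (1 - lam j (x j)) :=
        Finset.sum_le_sum_of_subset_of_nonneg (Finset.erase_subset _ _)
          fun j _ _ => sub_nonneg.2 (hlam1 _ _)
      have h4 : 0 ≤ ∑ j ∈ Finset.univ.erase i, (1 - lam j (x j)) :=
        Finset.sum_nonneg fun j _ => sub_nonneg.2 (hlam1 _ _)
      rw [h1]
      have h5 := mul_le_mul_of_nonneg_left h2 (hlam0 i a)
      have h6 := mul_le_mul_of_nonneg_right (hlam1 i a) h4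
      linarith
    have hsumup : ∑ x, cliqueIndicator E (Function.update x i a) *
        ((∏ j, lam j (Function.update x i a j)) / 2) ≤ lam i a * N i a / 2 := by
      rw [mul_comm (lam i a), mul_div_assoc, Finset.sum_mul]
      refine Finset.sum_le_sum fun x _ => ?_
      have := hE.cliqueIndicator_nonneg (Function.update x i a)
      gcongr
      exact hup x
    have hsumlow : (lam i a * N i a - ∑ x : Fin r → Fin n, ∑ j, (1 - lam j (x j))) / 2 ≤
        ∑ x, cliqueIndicator E (Function.update x i a) *
        ((∏ j, lam j (Function.update x i a j)) / 2) := by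
      rw [mul_comm (lam i a), Finset.sum_mul, ← Finset.sum_sub_distrib, Finset.sum_div]
      refine Finset.sum_le_sum fun x _ => ?_
      have h1 := hE.cliqueIndicator_nonneg (Function.update x i a)
      have h2 := hE.cliqueIndicator_le_one (Function.update x i a)
      have h3 : 0 ≤ ∑ j, (1 - lam j (x j)) :=
        Finset.sum_nonneg fun j _ => sub_nonneg.2 (hlam1 _ _)
      have h4 := mul_le_mul_of_nonneg_left (hlow x) h1
      have h5 := mul_le_mul_of_nonneg_right h2 h3
      linarith
    have hdouble : ∑ x : Fin r → Fin n, ∑ j, (1 - lam j (x j)) ≤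
        r * ((2 * (r : ℝ) ^ 2 + r) * ε / P) * Q := by
      rw [Finset.sum_comm]
      refine (Finset.sum_le_sum fun j _ => hcoord j).trans ?_
      simp [mul_assoc]
    have hδQ := mul_le_mul_of_nonneg_right hδ hQ.le
    have h0 : 0 ≤ δ * Q := le_trans (by positivity) hδQ
    rw [abs_le]
    constructor
    · linarith [hlamN i a]
    · linarith [hlamN' i a]

lemma exists_perfect (hE : IsSuperRegularSystem E D d ε) (hd : 0 < d) (hd1 : d ≤ 1)
    (hε : 0 ≤ ε) (hεd : ε ≤ d / 2) (hr : 0 < r) (hn : 0 < n)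
    (hbad : r * (4 * ε / d ^ 2) ≤ 1 / 4)
    {p μ δ : ℝ} (hp : p = d ^ r ^ 2) (hμ : 0 < μ)
    (hμε : μ ≤ p * (d ^ 2 / 4) ^ r - (r : ℝ) ^ 2 * ε)
    (hδ : ((r : ℝ) ^ 2 + r) * ε + r * ((2 * (r : ℝ) ^ 2 + r) * ε / p) ≤ δ)
    (hδp : δ ≤ p / 8) (hδμ : r * (4 * δ / μ) ≤ p ^ r / 4) :
    ∃ ω : (Fin r → Fin n) → ℝ, (∀ x, 0 ≤ ω x ∧ ω x ≤ 1) ∧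
      ∀ i a, ∑ x, cliqueIndicator E (Function.update x i a) * ω (Function.update x i a) =
        1 / 2 * (∏ q ∈ upperPairs r, D q.1 q.2) * (n : ℝ) ^ r := by
  have hn' : (0 : ℝ) < n := by exact_mod_cast hn
  have hp0 : 0 < p := hp ▸ by positivity
  have hp1 : p ≤ 1 := hp ▸ pow_le_one₀ hd.le hd1
  set P := ∏ q ∈ upperPairs r, D q.1 q.2 with hP
  have hpP : p ≤ P := hp ▸ hE.pow_le_prod_density hd.le hd1 subset_rfl
  have hP0 : 0 < P := hp0.trans_le hpP
  have hδ0 : 0 ≤ δ := le_trans (by positivity) hδ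
  have hQ : (0 : ℝ) < (n : ℝ) ^ r := by positivity
  obtain ⟨ω₁, hω₁, hs⟩ := hE.exists_almost_perfect hd hε (by linarith) hn hP hP0 (δ := δ)
    (le_trans (by gcongr) hδ)
  obtain ⟨τ, hτ, ht⟩ := hE.exists_correction hd hd1 hε hεd hn hbad hμ (hp ▸ hμε) hδ0 _ hs
  set t : ℝ := ∑ x, cliqueIndicator E x * ω₁ x with htdef
  have hmean : ∀ i, ∑ b, (P / 2 * (n : ℝ) ^ r - ∑ x, cliqueIndicator E (Function.update x i b) *
      ω₁ (Function.update x i b)) = n * (P / 2 * (n : ℝ) ^ r - t) := fun i => by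
    rw [Finset.sum_sub_distrib, Finset.sum_comm,
      sum_sum_update i (fun x => cliqueIndicator E x * ω₁ x)]
    simp
    ring
  have ht' : |P / 2 * (n : ℝ) ^ r - t| ≤ δ * (n : ℝ) ^ r := by
    have h1 := Finset.abs_sum_le_sum_abs (fun b => P / 2 * (n : ℝ) ^ r -
      ∑ x, cliqueIndicator E (Function.update x ⟨0, hr⟩ b) * ω₁ (Function.update x ⟨0, hr⟩ b))
      Finset.univ
    have h2 := h1.trans (Finset.sum_le_sum fun b _ => hs ⟨0, hr⟩ b)
    rw [hmean, abs_mul, abs_of_pos hn', Finset.sum_const, Finset.card_univ, Fintype.card_fin,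
      nsmul_eq_mul] at h2
    exact le_of_mul_le_mul_left h2 hn'
  have hsum : ∀ i a, ∑ x, cliqueIndicator E (Function.update x i a) *
      (ω₁ (Function.update x i a) + τ (Function.update x i a)) = t := fun i a => by
    simp only [mul_add, Finset.sum_add_distrib]
    rw [ht, hmean, mul_div_cancel_left₀ _ hn'.ne']
    ring
  have htP : 3 / 8 * P * (n : ℝ) ^ r ≤ t := by
    have h1 : δ * (n : ℝ) ^ r ≤ P / 8 * (n : ℝ) ^ r := by
      gcongr
      linarith
    linarith [(abs_le.1 ht').2]
  have ht0 : 0 < t := lt_of_lt_of_le (by positivity) htP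
  refine ⟨fun x => P / 2 * (n : ℝ) ^ r / t * (ω₁ x + τ x), fun x => ?_, fun i a => ?_⟩
  · have h1 := (hω₁ x).1
    have h2 := (hω₁ x).2
    have h3 := abs_le.1 ((hτ x).trans hδμ)
    have h4 : p ^ r ≤ P ^ r := by gcongr
    have h5 : p ^ r ≤ 1 := pow_le_one₀ hp0.le hp1
    have h6 : 0 < p ^ r := by positivity
    have h7 : P / 2 * (n : ℝ) ^ r / t ≤ 4 / 3 := by
      rw [div_le_iff₀ ht0]
      linarith
    have h8 : 0 ≤ ω₁ x + τ x := by linarith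
    have h9 : ω₁ x + τ x ≤ 3 / 4 := by linarith
    refine ⟨by positivity, ?_⟩
    calc P / 2 * (n : ℝ) ^ r / t * (ω₁ x + τ x) ≤ 4 / 3 * (3 / 4) := by gcongr
      _ = 1 := by norm_num
  · simp only [mul_left_comm (cliqueIndicator E _), ← Finset.mul_sum]
    rw [hsum, div_mul_cancel₀ _ ht0.ne']
    ring

end IsSuperRegularSystem

end System

section Graph

lemma nbrCount_eq_sum (G : SimpleGraph V) [DecidableRel G.Adj] (v : V) (B : Finset V) :
    (nbrCount G v B : ℝ) = ∑ w ∈ B, if G.Adj v w then (1 : ℝ) else 0 := by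
  simp [nbrCount]

lemma sum_nbrCount_comm (G : SimpleGraph V) [DecidableRel G.Adj] (A B : Finset V) :
    ∑ v ∈ A, (nbrCount G v B : ℝ) = ∑ w ∈ B, (nbrCount G w A : ℝ) := by
  simp_rw [nbrCount_eq_sum]
  rw [Finset.sum_comm]
  simp_rw [G.adj_comm]

lemma pairDensity_comm (G : SimpleGraph V) [DecidableRel G.Adj] (A B : Finset V) :
    pairDensity G A B = pairDensity G B A := by
  rw [pairDensity, pairDensity, sum_nbrCount_comm, mul_comm (A.card : ℝ)]

lemma sum_nbrCount_le (G : SimpleGraph V) [DecidableRel G.Adj] (A B : Finset V) :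
    ∑ v ∈ A, (nbrCount G v B : ℝ) ≤ A.card * B.card := by
  refine (Finset.sum_le_sum fun v _ => (Nat.cast_le.2 (Finset.card_filter_le _ _) :
    (nbrCount G v B : ℝ) ≤ B.card)).trans ?_
  simp

lemma pairDensity_le_one (G : SimpleGraph V) [DecidableRel G.Adj] (A B : Finset V) :
    pairDensity G A B ≤ 1 :=
  div_le_one_of_le₀ (sum_nbrCount_le G A B) (by positivity)

/-- Regularity in the form of a bound on the cut norm. -/
lemma IsRegularPair.abs_sum_nbrCount_sub_le {G : SimpleGraph V} [DecidableRel G.Adj]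
    {A B : Finset V} {d ε : ℝ} (h : IsRegularPair G A B d ε) (hd : 0 ≤ d) (hd1 : d ≤ 1)
    (hε : 0 ≤ ε) {X Y : Finset V} (hX : X ⊆ A) (hY : Y ⊆ B) :
    |∑ v ∈ X, (nbrCount G v Y : ℝ) - d * (X.card * Y.card)| ≤ ε * (A.card * B.card) := by
  have hXA : (X.card : ℝ) ≤ A.card := by exact_mod_cast Finset.card_le_card hX
  have hYB : (Y.card : ℝ) ≤ B.card := by exact_mod_cast Finset.card_le_card hY
  have hX0 : (0 : ℝ) ≤ X.card := Nat.cast_nonneg _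
  have hY0 : (0 : ℝ) ≤ Y.card := Nat.cast_nonneg _
  have h0 : (0 : ℝ) ≤ ∑ v ∈ X, (nbrCount G v Y : ℝ) := Finset.sum_nonneg fun _ _ => by positivity
  have h1 := sum_nbrCount_le G X Y
  have h2 : 0 ≤ d * ((X.card : ℝ) * Y.card) := by positivity
  have h3 : d * ((X.card : ℝ) * Y.card) ≤ 1 * (X.card * Y.card) := by gcongr
  have htriv : |∑ v ∈ X, (nbrCount G v Y : ℝ) - d * (X.card * Y.card)| ≤ X.card * Y.card :=
    abs_le.2 ⟨by linarith, by linarith⟩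
  by_cases hXε : ε * A.card ≤ X.card
  · by_cases hYε : ε * B.card ≤ Y.card
    · by_cases hpos : (X.card : ℝ) * Y.card = 0
      · rw [hpos] at htriv
        rw [hpos]
        exact htriv.trans (by positivity)
      · have hreg := h.2 X hX Y hY hXε hYε
        have hid : ∑ v ∈ X, (nbrCount G v Y : ℝ) - d * (X.card * Y.card) =
            (pairDensity G X Y - d) * (X.card * Y.card) := by
          rw [sub_mul, pairDensity, div_mul_cancel₀ _ hpos]
        rw [hid, abs_mul, abs_of_nonneg (by positivity : (0 : ℝ) ≤ X.card * Y.card)]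
        gcongr
    · refine htriv.trans ?_
      calc (X.card : ℝ) * Y.card ≤ A.card * (ε * B.card) := by
            gcongr
            exact (not_le.1 hYε).le
        _ = ε * (A.card * B.card) := by ring
  · refine htriv.trans ?_
    calc (X.card : ℝ) * Y.card ≤ (ε * A.card) * B.card := by
          gcongr
          exact (not_le.1 hXε).le
      _ = ε * (A.card * B.card) := by ring

end Graph

section Labelling

variable {r n : ℕ}

/-- The edge indicators of an `r`-partite graph whose parts are labelled by `v`, set to `1` inside
the parts. -/
noncomputable def edgeIndicator (G : SimpleGraph V) [DecidableRel G.Adj] (v : Fin r → Fin n → V)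
    (i j : Fin r) (a b : Fin n) : ℝ :=
  if i = j then 1 else if G.Adj (v i a) (v j b) then 1 else 0

lemma edgeIndicator_system {G : SimpleGraph V} [DecidableRel G.Adj] {A : Fin r → Finset V}
    {D : Fin r → Fin r → ℝ} {d ε : ℝ} (hd : 0 < d) (hd1 : d ≤ 1) (hε : 0 ≤ ε)
    (hcard : ∀ i, (A i).card = n) {v : Fin r → Fin n → V}
    (hinj : ∀ i, Function.Injective (v i)) (himage : ∀ i, Finset.univ.image (v i) = A i)
    (h : ∀ i j, i ≠ j → d ≤ D i j ∧ IsSuperRegular G (A i) (A j) (D i j) ε) :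
    IsSuperRegularSystem (edgeIndicator G v) (fun i j => if i = j then 1 else D i j) d ε where
  zero_or_one i j a b := by
    unfold edgeIndicator
    split_ifs <;> simp
  symm i j a b := by
    simp only [edgeIndicator, eq_comm (a := i), G.adj_comm]
  diag i a b := by simp [edgeIndicator]
  density_symm i j := by
    by_cases hij : i = j
    · simp [hij]
    · simp only [if_neg hij, if_neg (Ne.symm hij)]
      rw [← (h i j hij).2.1.1, ← (h j i (Ne.symm hij)).2.1.1, pairDensity_comm]
  density_diag i := by simp
  le_density i j := by
    split_ifs with hij
    · exact hd1
    · exact (h i j hij).1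
  density_le_one i j := by
    split_ifs with hij
    · exact le_rfl
    · rw [← (h i j hij).2.1.1]
      exact pairDensity_le_one _ _ _
  cut i j hij f g hf hg := by
    have hD1 : D i j ≤ 1 := by
      rw [← (h i j hij).2.1.1]
      exact pairDensity_le_one _ _ _
    have hsum : ∀ k (c : Fin n → ℝ), (∀ a, c a = 0 ∨ c a = 1) → ∀ q : V → ℝ,
        ∑ w ∈ (Finset.univ.filter fun a => c a = 1).image (v k), q w = ∑ a, c a * q (v k a) := by
      intro k c hc q
      rw [Finset.sum_image fun a _ b _ hab => hinj k hab, Finset.sum_filter]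
      refine Finset.sum_congr rfl fun a _ => ?_
      rcases hc a with h0 | h0 <;> simp [h0]
    have hsub : ∀ k (c : Fin n → ℝ),
        (Finset.univ.filter fun a => c a = 1).image (v k) ⊆ A k := fun k c => by
      rw [← himage k]
      exact Finset.image_subset_image (Finset.filter_subset _ _)
    have hcut := (h i j hij).2.1.abs_sum_nbrCount_sub_le (hd.le.trans (h i j hij).1) hD1 hε
      (hsub i f) (hsub j g)
    have hcardsum : ∀ k (c : Fin n → ℝ), (∀ a, c a = 0 ∨ c a = 1) →
        (((Finset.univ.filter fun a => c a = 1).image (v k)).card : ℝ) = ∑ a, c a := by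
      intro k c hc
      simpa using hsum k c hc fun _ => 1
    rw [hsum i f hf, hcardsum i f hf, hcardsum j g hg, hcard, hcard, ← pow_two] at hcut
    convert hcut using 2
    rw [Finset.sum_mul_sum, Finset.mul_sum, ← Finset.sum_sub_distrib]
    refine Finset.sum_congr rfl fun a _ => ?_
    rw [nbrCount_eq_sum, hsum j g hg, Finset.mul_sum, Finset.mul_sum, ← Finset.sum_sub_distrib]
    refine Finset.sum_congr rfl fun b _ => ?_
    simp only [edgeIndicator, if_neg hij]
    ring
  degree i j a := by
    by_cases hij : i = j
    · simp only [edgeIndicator, if_pos hij, Finset.sum_const, Finset.card_univ, Fintype.card_fin,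
        nsmul_eq_mul, mul_one]
      nlinarith [(Nat.cast_nonneg n : (0 : ℝ) ≤ n)]
    · have hdeg := (h i j hij).2.2.1 (v i a)
        (himage i ▸ Finset.mem_image_of_mem _ (Finset.mem_univ a))
      rw [nbrCount_eq_sum, hcard] at hdeg
      simp only [edgeIndicator, if_neg hij]
      refine hdeg.trans_eq ?_
      rw [← himage j, Finset.sum_image fun a _ b _ hab => hinj j hab]

variable {A : Fin r → Finset V} {v : Fin r → Fin n → V}

lemma eq_and_eq_of_label_eq (hdisj : Pairwise fun i j => Disjoint (A i) (A j))
    (hinj : ∀ i, Function.Injective (v i)) (hmem : ∀ i a, v i a ∈ A i) {i j : Fin r} {a b : Fin n}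
    (h : v i a = v j b) : i = j ∧ a = b := by
  have hij : i = j := by
    by_contra hne
    exact Finset.disjoint_left.1 (hdisj hne) (hmem i a) (h ▸ hmem j b)
  subst hij
  exact ⟨rfl, hinj i h⟩

/-- The transversal with labels `x`. -/
def transversal (v : Fin r → Fin n → V) (x : Fin r → Fin n) : Finset V :=
  Finset.univ.image fun i => v i (x i)

lemma mem_transversal (hdisj : Pairwise fun i j => Disjoint (A i) (A j))
    (hinj : ∀ i, Function.Injective (v i)) (hmem : ∀ i a, v i a ∈ A i) {x : Fin r → Fin n}
    {i : Fin r} {a : Fin n} : v i a ∈ transversal v x ↔ x i = a := by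
  simp only [transversal, Finset.mem_image, Finset.mem_univ, true_and]
  constructor
  · rintro ⟨j, hj⟩
    obtain ⟨rfl, h⟩ := eq_and_eq_of_label_eq hdisj hinj hmem hj
    exact h
  · rintro rfl
    exact ⟨i, rfl⟩

lemma transversal_injective (hdisj : Pairwise fun i j => Disjoint (A i) (A j))
    (hinj : ∀ i, Function.Injective (v i)) (hmem : ∀ i a, v i a ∈ A i) :
    Function.Injective (transversal v) := by
  intro x y hxy
  ext i
  have h := (mem_transversal hdisj hinj hmem (x := x) (i := i)).2 rfl
  rw [hxy, mem_transversal hdisj hinj hmem] at h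
  rw [h]

lemma cliqueIndicator_edgeIndicator_eq_one_iff (G : SimpleGraph V) [DecidableRel G.Adj]
    (hdisj : Pairwise fun i j => Disjoint (A i) (A j))
    (hinj : ∀ i, Function.Injective (v i)) (hmem : ∀ i a, v i a ∈ A i) (x : Fin r → Fin n) :
    cliqueIndicator (edgeIndicator G v) x = 1 ↔
      G.IsClique (transversal v x : Set V) := by
  constructor
  · intro h
    have hadj : ∀ i j, i < j → G.Adj (v i (x i)) (v j (x j)) := by
      intro i j hij
      by_contra hn
      have : cliqueIndicator (edgeIndicator G v) x = 0 :=
        Finset.prod_eq_zero (i := (i, j)) (by simp [upperPairs, hij])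
          (by simp [edgeIndicator, hij.ne, hn])
      linarith
    intro u hu w hw huw
    simp only [transversal, Finset.coe_image, Finset.coe_univ, Set.image_univ,
      Set.mem_range] at hu hw
    obtain ⟨i, rfl⟩ := hu
    obtain ⟨j, rfl⟩ := hw
    have hij : i ≠ j := fun hij => huw (by rw [hij])
    rcases lt_or_gt_of_ne hij with hlt | hlt
    · exact hadj i j hlt
    · exact (hadj j i hlt).symm
  · intro h
    refine Finset.prod_eq_one fun p hp => ?_
    have hne : p.1 ≠ p.2 := by
      simp only [upperPairs, Finset.mem_filter, Finset.mem_univ, true_and] at hp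
      exact hp.ne
    have hadj : G.Adj (v p.1 (x p.1)) (v p.2 (x p.2)) :=
      h (by simp [transversal]) (by simp [transversal])
        fun h' => hne (eq_and_eq_of_label_eq hdisj hinj hmem h').1
    simp [edgeIndicator, hadj]

lemma mem_transvCliques_iff (G : SimpleGraph V) [DecidableRel G.Adj]
    (hdisj : Pairwise fun i j => Disjoint (A i) (A j))
    (hcover : (Finset.univ : Finset V) = Finset.univ.biUnion A)
    (hinj : ∀ i, Function.Injective (v i)) (himage : ∀ i, Finset.univ.image (v i) = A i)
    (K : Finset V) :
    K ∈ transvCliques G A ↔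
      ∃ x, cliqueIndicator (edgeIndicator G v) x = 1 ∧ transversal v x = K := by
  have hmem : ∀ i a, v i a ∈ A i := fun i a =>
    himage i ▸ Finset.mem_image_of_mem _ (Finset.mem_univ a)
  simp only [transvCliques, Finset.mem_filter, Finset.mem_univ, true_and]
  constructor
  · rintro ⟨hK, hone⟩
    have hx : ∀ i, ∃ a, K ∩ A i = {v i a} := fun i => by
      obtain ⟨w, hw⟩ := Finset.card_eq_one.1 (hone i)
      have hwA : w ∈ A i := (Finset.mem_inter.1 (hw ▸ Finset.mem_singleton_self w)).2
      rw [← himage i] at hwA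
      obtain ⟨a, -, rfl⟩ := Finset.mem_image.1 hwA
      exact ⟨a, hw⟩
    choose x hx using hx
    have hxK : transversal v x = K := by
      ext w
      simp only [transversal, Finset.mem_image, Finset.mem_univ, true_and]
      constructor
      · rintro ⟨i, rfl⟩
        exact (Finset.mem_inter.1 (hx i ▸ Finset.mem_singleton_self (v i (x i)))).1
      · intro hw
        have hw' := Finset.mem_univ w
        rw [hcover] at hw'
        obtain ⟨i, -, hi⟩ := Finset.mem_biUnion.1 hw'
        have := Finset.mem_inter.2 ⟨hw, hi⟩
        rw [hx i, Finset.mem_singleton] at this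
        exact ⟨i, this.symm⟩
    exact ⟨x, (cliqueIndicator_edgeIndicator_eq_one_iff G hdisj hinj hmem x).2 (hxK ▸ hK), hxK⟩
  · rintro ⟨x, hx, rfl⟩
    refine ⟨(cliqueIndicator_edgeIndicator_eq_one_iff G hdisj hinj hmem x).1 hx, fun i => ?_⟩
    refine Finset.card_eq_one.2 ⟨v i (x i), ?_⟩
    ext w
    rw [Finset.mem_inter, Finset.mem_singleton]
    constructor
    · rintro ⟨h1, h2⟩
      rw [← himage i] at h2
      obtain ⟨a, -, rfl⟩ := Finset.mem_image.1 h2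
      rw [(mem_transversal hdisj hinj hmem).1 h1]
    · rintro rfl
      exact ⟨(mem_transversal hdisj hinj hmem).2 rfl, hmem _ _⟩

lemma sum_transvCliques_mem (G : SimpleGraph V) [DecidableRel G.Adj]
    (hdisj : Pairwise fun i j => Disjoint (A i) (A j))
    (hcover : (Finset.univ : Finset V) = Finset.univ.biUnion A)
    (hinj : ∀ i, Function.Injective (v i)) (himage : ∀ i, Finset.univ.image (v i) = A i)
    (h01 : ∀ x, cliqueIndicator (edgeIndicator G v) x = 0 ∨
      cliqueIndicator (edgeIndicator G v) x = 1)
    (ω : (Fin r → Fin n) → ℝ) (i : Fin r) (a : Fin n) :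
    ∑ K ∈ (transvCliques G A).filter (fun K => v i a ∈ K),
        Function.extend (transversal v) ω 0 K =
      ∑ x, if x i = a then cliqueIndicator (edgeIndicator G v) x * ω x else 0 := by
  have hmem : ∀ i a, v i a ∈ A i := fun i a =>
    himage i ▸ Finset.mem_image_of_mem _ (Finset.mem_univ a)
  have htinj := transversal_injective hdisj hinj hmem
  have hset : (transvCliques G A).filter (fun K => v i a ∈ K) =
      (Finset.univ.filter fun x => x i = a ∧
        cliqueIndicator (edgeIndicator G v) x = 1).image (transversal v) := by
    ext K
    rw [Finset.mem_filter, mem_transvCliques_iff G hdisj hcover hinj himage]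
    simp only [Finset.mem_image, Finset.mem_filter, Finset.mem_univ, true_and]
    constructor
    · rintro ⟨⟨x, hx, rfl⟩, hK⟩
      exact ⟨x, ⟨(mem_transversal hdisj hinj hmem).1 hK, hx⟩, rfl⟩
    · rintro ⟨x, ⟨hxa, hx⟩, rfl⟩
      exact ⟨⟨x, hx, rfl⟩, (mem_transversal hdisj hinj hmem).2 hxa⟩
  rw [hset, Finset.sum_image fun x _ y _ h => htinj h, Finset.sum_filter]
  refine Finset.sum_congr rfl fun x _ => ?_
  rw [htinj.extend_apply]
  rcases h01 x with h | h <;> simp [h]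

end Labelling

lemma exists_pos_forall_mul_le (c : ℝ) {b : ℝ} (hb : 0 < b) :
    ∃ ε₀ : ℝ, 0 < ε₀ ∧ ∀ ε, 0 < ε → ε ≤ ε₀ → c * ε ≤ b := by
  refine ⟨b / (|c| + 1), by positivity, fun ε hε h => ?_⟩
  rw [le_div_iff₀ (by positivity)] at h
  nlinarith [le_abs_self c]

/-- Fractional matching lemma: in an `r`-partite system of `(d_{i,j},ε)`-super-regular pairs
with `d_{i,j} ≥ d`, the hypergraph `𝓗` of `r`-partite cliques admits a fractional perfect
matching `ω : 𝓗 → [0,1]` with `∑_{H ∋ v} ω(H) = ½ n^{r-1} ∏_{i<j} d_{i,j}` for every vertex. -/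
theorem statement13 :
    ∀ r : ℕ, 2 ≤ r → ∀ d : ℝ, 0 < d → d ≤ 2 / 3 →
    ∃ ε₀ : ℝ, 0 < ε₀ ∧ ∃ n₀ : ℕ, ∀ ε : ℝ, 0 < ε → ε ≤ ε₀ → ∀ n : ℕ, n₀ ≤ n →
    ∀ (V : Type) (_ : Fintype V) (_ : DecidableEq V)
      (G : SimpleGraph V) (_ : DecidableRel G.Adj) (A : Fin r → Finset V)
      (D : Fin r → Fin r → ℝ),
    (∀ i, (A i).card = n) →
    (Finset.univ : Finset V) = Finset.univ.biUnion A →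
    (Pairwise fun i j => Disjoint (A i) (A j)) →
    (∀ i, ∀ u ∈ A i, ∀ v ∈ A i, ¬ G.Adj u v) →
    (∀ i j, i ≠ j → d ≤ D i j ∧ IsSuperRegular G (A i) (A j) (D i j) ε) →
    ∃ ω : Finset V → ℝ,
      (∀ K ∈ transvCliques G A, 0 ≤ ω K ∧ ω K ≤ 1) ∧
      ∀ v : V,
        ∑ K ∈ (transvCliques G A).filter (fun K => v ∈ K), ω K =
          (1 / 2) * (n : ℝ) ^ (r - 1) *
            ∏ p ∈ Finset.univ.filter (fun p : Fin r × Fin r => p.1 < p.2), D p.1 p.2 := by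
  intro r hr d hd hd23
  have hr' : (0 : ℝ) < r := by exact_mod_cast (by omega : 0 < r)
  set p : ℝ := d ^ r ^ 2 with hp
  have hp0 : 0 < p := by positivity
  set μ : ℝ := p * (d ^ 2 / 4) ^ r / 2 with hμdef
  have hμ : 0 < μ := by positivity
  set C : ℝ := ((r : ℝ) ^ 2 + r) + r * ((2 * (r : ℝ) ^ 2 + r) / p) with hC
  obtain ⟨ε₁, h₁0, h₁⟩ := exists_pos_forall_mul_le (r * (4 / d ^ 2)) (by norm_num : (0 : ℝ) < 1 / 4)
  obtain ⟨ε₂, h₂0, h₂⟩ := exists_pos_forall_mul_le ((r : ℝ) ^ 2) hμ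
  obtain ⟨ε₃, h₃0, h₃⟩ := exists_pos_forall_mul_le C (by positivity : 0 < p / 8)
  obtain ⟨ε₄, h₄0, h₄⟩ := exists_pos_forall_mul_le (r * (4 * C / μ)) (by positivity : 0 < p ^ r / 4)
  refine ⟨min (d / 2) (min (min ε₁ ε₂) (min ε₃ ε₄)), by positivity, 1, ?_⟩
  intro ε hε hεle n hn V _ _ G _ A D hcard hcover hdisj _ hreg
  simp only [le_min_iff] at hεle
  obtain ⟨hεd, ⟨hε₁, hε₂⟩, hε₃, hε₄⟩ := hεle
  have hn' : (0 : ℝ) < n := by exact_mod_cast hn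
  let e : ∀ i, Fin n ≃ A i := fun i => (Finset.equivFinOfCardEq (hcard i)).symm
  let v : Fin r → Fin n → V := fun i a => e i a
  have hinj : ∀ i, Function.Injective (v i) := fun i =>
    Subtype.val_injective.comp (e i).injective
  have himage : ∀ i, Finset.univ.image (v i) = A i := fun i => by
    ext w
    simp only [Finset.mem_image, Finset.mem_univ, true_and]
    constructor
    · rintro ⟨a, rfl⟩
      exact (e i a).2
    · intro hw
      exact ⟨(e i).symm ⟨w, hw⟩, by simp [v]⟩
  have hE := edgeIndicator_system hd (by linarith) hε.le hcard hinj himage hreg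
  obtain ⟨ω, hω, hsum⟩ := hE.exists_perfect hd (by linarith) hε.le hεd (by omega) hn
    ((by ring : r * (4 * ε / d ^ 2) = r * (4 / d ^ 2) * ε).trans_le (h₁ ε hε hε₁)) hp hμ
    (by linarith [h₂ ε hε hε₂]) (δ := C * ε) (le_of_eq (by rw [hC]; ring)) (h₃ ε hε hε₃)
    ((by ring : r * (4 * (C * ε) / μ) = r * (4 * C / μ) * ε).trans_le (h₄ ε hε hε₄))
  have hmem : ∀ i a, v i a ∈ A i := fun i a => (e i a).2
  have htinj := transversal_injective hdisj hinj hmem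
  refine ⟨Function.extend (transversal v) ω 0, fun K hK => ?_, fun w => ?_⟩
  · obtain ⟨x, -, rfl⟩ := (mem_transvCliques_iff G hdisj hcover hinj himage K).1 hK
    rw [htinj.extend_apply]
    exact hω x
  · have hw := Finset.mem_univ w
    rw [hcover] at hw
    obtain ⟨i, -, hi⟩ := Finset.mem_biUnion.1 hw
    rw [← himage i] at hi
    obtain ⟨a, -, rfl⟩ := Finset.mem_image.1 hi
    have hprod : ∏ q ∈ upperPairs r, (if q.1 = q.2 then 1 else D q.1 q.2) =
        ∏ q ∈ upperPairs r, D q.1 q.2 := Finset.prod_congr rfl fun q hq => by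
      rw [if_neg (Finset.mem_filter.1 hq).2.ne]
    have h := hsum i a
    rw [sum_update i a fun x => cliqueIndicator (edgeIndicator G v) x * ω x, hprod,
      show (n : ℝ) ^ r = n ^ (r - 1) * n by rw [← pow_succ, Nat.sub_add_cancel (by omega)]] at h
    rw [sum_transvCliques_mem G hdisj hcover hinj himage hE.cliqueIndicator_zero_or_one]
    refine mul_left_cancel₀ hn'.ne' (h.trans ?_)
    rw [upperPairs]
    ring
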